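/- arXiv:1105.1440 — 2 statements merged into one kernel-verified Lean document; each statement's English description precedes it below -/
import Mathlib

section
/- Let p and h be distinct prime numbers and let l be a positive integer. If there exists a nontrivial group homomorphism from the cyclic group Z/hZ to the general linear group GL_l(F_p), then the multiplicative order of p modulo h (that is, the order of the residue class of p in the unit group (Z/hZ)^*) is at most l. -/
/-- If `p ≠ h` are primes, `l ≥ 1`, and there is a nontrivial group homomorphism from
`ℤ/hℤ` to `GL_l(𝔽_p)`, then the multiplicative order of `p` modulo `h` is at most `l`. -/
theorem stmt_2 (p h : ℕ) (hp : p.Prime) (hh : h.Prime) (hph : p ≠ h) (l : ℕ) (hl : 1 ≤ l)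
    (f : Multiplicative (ZMod h) →* Matrix.GeneralLinearGroup (Fin l) (ZMod p))
    (hf : f ≠ 1) :
    orderOf (p : ZMod h) ≤ l := by
  haveI : Fact p.Prime := ⟨hp⟩
  haveI : Fact h.Prime := ⟨hh⟩
  obtain ⟨x, hx⟩ : ∃ x, f x ≠ 1 := by
    by_contra hc
    push Not at hc
    exact hf (MonoidHom.ext hc)
  have hxh : x ^ h = 1 := by
    have := pow_card_eq_one' (x := x)
    rwa [Nat.card_congr Multiplicative.toAdd, Nat.card_zmod] at this
  have ho : orderOf (f x) = h := orderOf_eq_prime (by rw [← map_pow, hxh, map_one]) hx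
  have hd : h ∣ Nat.card (Matrix.GeneralLinearGroup (Fin l) (ZMod p)) := by
    have := orderOf_dvd_natCard (f x)
    rwa [ho] at this
  rw [Matrix.card_GL_field, Prime.dvd_finset_prod_iff hh.prime] at hd
  obtain ⟨i, -, hi⟩ := hd
  rw [ZMod.card] at hi
  have hi' := (ZMod.natCast_eq_zero_iff _ _).2 hi
  rw [Nat.cast_sub (Nat.pow_le_pow_right hp.pos i.2.le), sub_eq_zero] at hi'
  push_cast at hi'
  have hp0 : (p : ZMod h) ≠ 0 := by
    rw [Ne, ZMod.natCast_eq_zero_iff, Nat.prime_dvd_prime_iff_eq hh hp]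
    exact hph.symm
  have hil := i.2
  have h1 : (p : ZMod h) ^ (l - i.1) = 1 := by
    apply mul_left_cancel₀ (pow_ne_zero i.1 hp0)
    rw [← pow_add, mul_one, Nat.add_sub_cancel' hil.le, hi']
  have := orderOf_le_of_pow_eq_one (by omega) h1
  omega
end

section
/- The number h = 63648628175761 is prime, the multiplicative order of 3 in the unit group (Z/hZ)^* equals f = 31824314087880, and moreover f^2 - 4f ≥ 160·h and h ≥ 484. -/
theorem pow_ne_aux (a : ZMod 63648628175761) (e r : ℕ) (h : a ^ e = (r : ZMod 63648628175761))
    (hr : r % 63648628175761 ≠ 1) : a ^ e ≠ 1 := by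
  rw [h]
  intro hh
  have h1 : ((r : ℕ) : ZMod 63648628175761) = ((1 : ℕ) : ZMod 63648628175761) := by
    rw [hh, Nat.cast_one]
  rw [ZMod.natCast_eq_natCast_iff'] at h1
  exact hr (by rw [h1])

theorem prime_cases_aux (p : ℕ) (hp : p.Prime) (hd : p ∣ 2 ^ 4 * 3 * 5 * 7211 * 36777509) :
    p = 2 ∨ p = 3 ∨ p = 5 ∨ p = 7211 ∨ p = 36777509 := by
  have h2 : Nat.Prime 7211 := by norm_num
  have h3 : Nat.Prime 36777509 := by norm_num
  rcases hp.dvd_mul.1 hd with hd | hd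
  · rcases hp.dvd_mul.1 hd with hd | hd
    · rcases hp.dvd_mul.1 hd with hd | hd
      · rcases hp.dvd_mul.1 hd with hd | hd
        · exact Or.inl ((Nat.prime_dvd_prime_iff_eq hp Nat.prime_two).1 (hp.dvd_of_dvd_pow hd))
        · exact Or.inr (Or.inl ((Nat.prime_dvd_prime_iff_eq hp Nat.prime_three).1 hd))
      · exact Or.inr (Or.inr (Or.inl ((Nat.prime_dvd_prime_iff_eq hp Nat.prime_five).1 hd)))
    · exact Or.inr (Or.inr (Or.inr (Or.inl ((Nat.prime_dvd_prime_iff_eq hp h2).1 hd))))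
  · exact Or.inr (Or.inr (Or.inr (Or.inr ((Nat.prime_dvd_prime_iff_eq hp h3).1 hd))))

theorem prime_aux : Nat.Prime 63648628175761 := by
  refine lucas_primality 63648628175761 ((13 : ℕ) : ZMod 63648628175761) ?_ ?_
  · rw [show ((63648628175761 : ℕ) - 1) = 63648628175760 by norm_num]
    rw [Nat.cast_ofNat]; reduce_mod_char
  · intro p hp hd
    rw [show ((63648628175761 : ℕ) - 1) = 63648628175760 by norm_num] at hd ⊢
    rcases prime_cases_aux p hp (hd.trans (by norm_num)) with rfl | rfl | rfl | rfl | rfl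
    · rw [show ((63648628175760 : ℕ) / 2) = 31824314087880 by norm_num]
      exact pow_ne_aux _ 31824314087880 63648628175760 (by rw [Nat.cast_ofNat, Nat.cast_ofNat]; reduce_mod_char) (by norm_num)
    · rw [show ((63648628175760 : ℕ) / 3) = 21216209391920 by norm_num]
      exact pow_ne_aux _ 21216209391920 63181760438838 (by rw [Nat.cast_ofNat, Nat.cast_ofNat]; reduce_mod_char) (by norm_num)
    · rw [show ((63648628175760 : ℕ) / 5) = 12729725635152 by norm_num]
      exact pow_ne_aux _ 12729725635152 63455891053252 (by rw [Nat.cast_ofNat, Nat.cast_ofNat]; reduce_mod_char) (by norm_num)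
    · rw [show ((63648628175760 : ℕ) / 7211) = 8826602160 by norm_num]
      exact pow_ne_aux _ 8826602160 1005391184322 (by rw [Nat.cast_ofNat, Nat.cast_ofNat]; reduce_mod_char) (by norm_num)
    · rw [show ((63648628175760 : ℕ) / 36777509) = 1730640 by norm_num]
      exact pow_ne_aux _ 1730640 58130272257446 (by rw [Nat.cast_ofNat, Nat.cast_ofNat]; reduce_mod_char) (by norm_num)

theorem order_aux : orderOf ((3 : ℕ) : ZMod 63648628175761) = 31824314087880 := by
  refine orderOf_eq_of_pow_and_pow_div_prime (by norm_num) ?_ ?_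
  · rw [Nat.cast_ofNat]; reduce_mod_char
  · intro p hp hd
    rcases prime_cases_aux p hp (hd.trans (by norm_num)) with rfl | rfl | rfl | rfl | rfl
    · rw [show ((31824314087880 : ℕ) / 2) = 15912157043940 by norm_num]
      exact pow_ne_aux _ 15912157043940 63648628175760 (by rw [Nat.cast_ofNat, Nat.cast_ofNat]; reduce_mod_char) (by norm_num)
    · rw [show ((31824314087880 : ℕ) / 3) = 10608104695960 by norm_num]
      exact pow_ne_aux _ 10608104695960 466867736922 (by rw [Nat.cast_ofNat, Nat.cast_ofNat]; reduce_mod_char) (by norm_num)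
    · rw [show ((31824314087880 : ℕ) / 5) = 6364862817576 by norm_num]
      exact pow_ne_aux _ 6364862817576 53888157948927 (by rw [Nat.cast_ofNat, Nat.cast_ofNat]; reduce_mod_char) (by norm_num)
    · rw [show ((31824314087880 : ℕ) / 7211) = 4413301080 by norm_num]
      exact pow_ne_aux _ 4413301080 40021444303075 (by rw [Nat.cast_ofNat, Nat.cast_ofNat]; reduce_mod_char) (by norm_num)
    · rw [show ((31824314087880 : ℕ) / 36777509) = 865320 by norm_num]
      exact pow_ne_aux _ 865320 30762508644822 (by rw [Nat.cast_ofNat, Nat.cast_ofNat]; reduce_mod_char) (by norm_num)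


/-- `h = 63648628175761` is prime, the multiplicative order of `3` in `(ℤ/hℤ)ˣ` is `31824314087880`,
and `f^2 - 4f ≥ 160·h` and `h ≥ 484`. -/
theorem stmt_9 :
    Nat.Prime 63648628175761 ∧
    orderOf ((3 : ℕ) : ZMod 63648628175761) = 31824314087880 ∧
    (31824314087880 : ℕ) ^ 2 - 4 * 31824314087880 ≥ 160 * 63648628175761 ∧
    (63648628175761 : ℕ) ≥ 484 := by
  exact ⟨prime_aux, order_aux, by norm_num, by norm_num⟩
end
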